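/- arXiv:math/0208103 — 2 statements merged into one kernel-verified Lean document; each statement's English description precedes it below -/
import Mathlib

section
/- Let M be an arbitrary subset of ℂ^N. Let f : closure(Δ) → ℂ^N be continuous on the closed unit disc, holomorphic on the open unit disc Δ, with f(bΔ) ⊆ M (f is an analytic disc attached to M). Let f* : closure(Δ) \ {0} → ℂ^N be continuous on the closed punctured disc and holomorphic on the open punctured disc, and suppose ζ ↦ ζ·f*(ζ) extends to a holomorphic function on all of Δ (f* has a pole of order at most 1 at 0). Assume f* is supporting, i.e. for every continuous g : closure(Δ) → ℂ^N that is holomorphic on Δ and satisfies g(bΔ) ⊆ M, one has Re⟨f*(ζ), g(ζ) − f(ζ)⟩ ≥ 0 for all ζ with |ζ| = 1, where ⟨u,v⟩ = ∑_{j=1}^N u_j v_j is the bilinear pairing. Then for every positive real trigonometric polynomial p, every such attached disc g, and every radius 0 < r < 1, one has Re( (1/(2πi)) ∮_{|ζ|=r} ζ^{-1} ⟨f*(ζ), g(ζ) − f(ζ)⟩ p(ζ) dζ ) ≥ 0, where p(ζ) = ∑_{j=-m}^{m} a_j ζ^j is evaluated as a Laurent polynomial. -/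
open Complex Metric

/-- The (Laurent) trigonometric polynomial `ζ ↦ ∑_{j=-m}^{m} a j * ζ^j`. -/
noncomputable def trigPoly (m : ℕ) (a : ℤ → ℂ) (ζ : ℂ) : ℂ :=
  ∑ j ∈ Finset.Icc (-(m : ℤ)) (m : ℤ), a j * ζ ^ j

theorem trigPoly_im_eq_zero (m : ℕ) (a : ℤ → ℂ) (ha : ∀ j : ℤ, a (-j) = starRingEnd ℂ (a j))
    {ζ : ℂ} (hζ : ‖ζ‖ = 1) : (trigPoly m a ζ).im = 0 := by
  rw [← conj_eq_iff_im]
  unfold trigPoly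
  rw [map_sum]
  refine Finset.sum_nbij' (fun j => -j) (fun j => -j) ?_ ?_ ?_ ?_ ?_
  · intro j hj
    simp only [Finset.mem_Icc] at hj ⊢
    omega
  · intro j hj
    simp only [Finset.mem_Icc] at hj ⊢
    omega
  · simp
  · simp
  · intro j _
    rw [ha, map_mul, map_zpow₀, ← inv_eq_conj hζ, inv_zpow, zpow_neg]

theorem differentiableAt_trigPoly (m : ℕ) (a : ℤ → ℂ) {ζ : ℂ} (hζ : ζ ≠ 0) :
    DifferentiableAt ℂ (trigPoly m a) ζ := by
  unfold trigPoly
  exact DifferentiableAt.fun_sum fun j _ =>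
    (differentiableAt_zpow.2 (Or.inl hζ)).const_mul _

/-- The mean of a function over the unit circle has nonnegative real part if the function does. -/
theorem re_circleIntegral_inv_mul_nonneg {h : ℂ → ℂ} (hc : ContinuousOn h (sphere 0 1))
    (hre : ∀ z ∈ sphere (0 : ℂ) 1, 0 ≤ (h z).re) :
    0 ≤ ((2 * Real.pi * I)⁻¹ * ∮ z in C(0, 1), z⁻¹ * h z).re := by
  have hmem (θ : ℝ) : circleMap 0 1 θ ∈ sphere (0 : ℂ) 1 :=
    circleMap_mem_sphere 0 zero_le_one θ
  have hcont : Continuous fun θ : ℝ => h (circleMap 0 1 θ) :=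
    hc.comp_continuous (continuous_circleMap 0 1) hmem
  have key : (2 * Real.pi * I)⁻¹ * (∮ z in C(0, 1), z⁻¹ * h z) =
      ((2 * Real.pi)⁻¹ : ℝ) * ∫ θ in (0 : ℝ)..2 * Real.pi, h (circleMap 0 1 θ) := by
    have hint : (∮ z in C(0, 1), z⁻¹ * h z) =
        I * ∫ θ in (0 : ℝ)..2 * Real.pi, h (circleMap 0 1 θ) := by
      rw [circleIntegral, ← intervalIntegral.integral_const_mul]
      refine intervalIntegral.integral_congr fun θ _ => ?_
      have hne : circleMap 0 1 θ ≠ 0 := circleMap_ne_center one_ne_zero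
      simp only [deriv_circleMap, smul_eq_mul]
      field_simp
    rw [hint]
    push_cast
    field_simp [I_ne_zero]
  rw [key, re_ofReal_mul]
  refine mul_nonneg (by positivity) ?_
  have hcomm := reCLM.intervalIntegral_comp_comm
    (hcont.intervalIntegrable (μ := MeasureTheory.volume) 0 (2 * Real.pi))
  simp only [reCLM_apply] at hcomm
  rw [← hcomm]
  exact intervalIntegral.integral_nonneg Real.two_pi_pos.le fun θ _ => hre _ (hmem θ)

/-- Lemma 4 of the paper: a disc attached to `M` with a supporting lift `f*` satisfies the
special extremal property with constant `C = 0`: for every positive real trigonometric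
polynomial `p`, every attached disc `g`, and every radius `0 < r < 1`,
`Re ((2πi)⁻¹ ∮_{|ζ|=r} ζ⁻¹ ⟨f*(ζ), g(ζ) − f(ζ)⟩ p(ζ) dζ) ≥ 0`. -/
theorem stmt0 (N : ℕ) (M : Set (Fin N → ℂ)) (f fstar : ℂ → Fin N → ℂ)
    (hf_cont : ContinuousOn f (closedBall 0 1))
    (hf_holo : DifferentiableOn ℂ f (ball 0 1))
    (hf_bd : ∀ ζ ∈ sphere (0 : ℂ) 1, f ζ ∈ M)
    (hfs_cont : ContinuousOn fstar (closedBall 0 1 \ {0}))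
    (hfs_holo : DifferentiableOn ℂ fstar (ball 0 1 \ {0}))
    (hpole : ∃ F : ℂ → Fin N → ℂ, DifferentiableOn ℂ F (ball 0 1) ∧
      ∀ ζ ∈ ball (0 : ℂ) 1 \ {0}, F ζ = ζ • fstar ζ)
    (hsupp : ∀ g : ℂ → Fin N → ℂ, ContinuousOn g (closedBall 0 1) →
      DifferentiableOn ℂ g (ball 0 1) → (∀ ζ ∈ sphere (0 : ℂ) 1, g ζ ∈ M) →
      ∀ ζ ∈ sphere (0 : ℂ) 1, 0 ≤ (∑ j, fstar ζ j * (g ζ j - f ζ j)).re) :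
    ∀ (m : ℕ) (a : ℤ → ℂ),
      (∀ j : ℤ, a (-j) = starRingEnd ℂ (a j)) →
      (∀ ζ : ℂ, ‖ζ‖ = 1 → 0 < (trigPoly m a ζ).re) →
      ∀ g : ℂ → Fin N → ℂ, ContinuousOn g (closedBall 0 1) →
        DifferentiableOn ℂ g (ball 0 1) → (∀ ζ ∈ sphere (0 : ℂ) 1, g ζ ∈ M) →
      ∀ r : ℝ, 0 < r → r < 1 →
        0 ≤ ((2 * Real.pi * I)⁻¹ *
          ∮ z in C(0, r), z⁻¹ * (∑ j, fstar z j * (g z j - f z j)) * trigPoly m a z).re := by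
  intro m a ha hp g hg_cont hg_holo hg_bd r hr0 hr1
  have hcont : ContinuousOn
      (fun z => (∑ j, fstar z j * (g z j - f z j)) * trigPoly m a z) (closedBall 0 1 \ {0}) := by
    refine ContinuousOn.mul (continuousOn_finsetSum _ fun j _ => ?_) fun z hz =>
      (differentiableAt_trigPoly m a hz.2).continuousAt.continuousWithinAt
    exact (continuousOn_pi.1 hfs_cont j).mul
      (((continuousOn_pi.1 hg_cont j).sub (continuousOn_pi.1 hf_cont j)).mono Set.sdiff_subset)
  have hdiff : DifferentiableOn ℂ
      (fun z => (∑ j, fstar z j * (g z j - f z j)) * trigPoly m a z) (ball 0 1 \ {0}) := by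
    refine DifferentiableOn.mul (DifferentiableOn.fun_sum fun j _ => ?_) fun z hz =>
      (differentiableAt_trigPoly m a hz.2).differentiableWithinAt
    exact (differentiableOn_pi.1 hfs_holo j).mul
      (((differentiableOn_pi.1 hg_holo j).sub (differentiableOn_pi.1 hf_holo j)).mono
        Set.sdiff_subset)
  have hradius := circleIntegral_eq_of_differentiable_on_annulus_off_countable
    (f := fun z => z⁻¹ * ((∑ j, fstar z j * (g z j - f z j)) * trigPoly m a z))
    (c := 0) hr0 hr1.le Set.countable_empty
    ?_ ?_
  · simp only [mul_assoc] at hradius ⊢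
    rw [← hradius]
    simp only [← mul_assoc (2 : ℂ)]
    refine re_circleIntegral_inv_mul_nonneg (hcont.mono fun z hz => ?_) fun z hz => ?_
    · exact ⟨sphere_subset_closedBall hz, ne_of_mem_sphere hz one_ne_zero⟩
    · have hz1 : ‖z‖ = 1 := mem_sphere_zero_iff_norm.1 hz
      rw [mul_re, trigPoly_im_eq_zero m a ha hz1, mul_zero, sub_zero]
      exact mul_nonneg (hsupp g hg_cont hg_holo hg_bd z hz) (hp z hz1).le
  · have hsub : closedBall (0 : ℂ) 1 \ ball 0 r ⊆ closedBall 0 1 \ {0} :=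
      Set.sdiff_subset_sdiff_right (Set.singleton_subset_iff.2 (mem_ball_self hr0))
    exact (continuousOn_inv₀.mono fun z hz => (hsub hz).2).mul (hcont.mono hsub)
  · rintro z ⟨⟨hz1, hzr⟩, -⟩
    have hz0 : z ≠ 0 := fun h => hzr (h ▸ mem_closedBall_self hr0.le)
    exact (differentiableAt_inv hz0).mul (hdiff.differentiableAt
      ((isOpen_ball.sdiff isClosed_singleton).mem_nhds ⟨hz1, hz0⟩))
end

section
/- Let ψ : ℂ → ℂ be continuous on the unit circle and suppose that ∫_0^{2π} ψ(e^{iθ}) e^{inθ} dθ = 0 for every integer n ≥ 0. Then there exists a function Ψ : ℂ → ℂ that is continuous on the closed unit disc, holomorphic on the open unit disc, satisfies Ψ(ζ) = ψ(ζ) for all |ζ| = 1, and satisfies Ψ(0) = 0. -/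
open Complex Metric

section PoissonIntegral

open Real MeasureTheory
open scoped ComplexConjugate

theorem circleIntegrable_poissonKernel_smul {f : ℂ → ℂ} (hf : ContinuousOn f (sphere 0 1))
    {w : ℂ} (hw : w ∈ ball (0 : ℂ) 1) : CircleIntegrable (poissonKernel 0 w • f) 0 1 := by
  refine ContinuousOn.circleIntegrable zero_le_one (ContinuousOn.smul ?_ hf)
  rw [poissonKernel_eq_re_herglotzRieszKernel]
  exact continuous_re.comp_continuousOn
    (by simpa using continuousOn_herglotzRieszKernel_sphere (R := 1) hw)

theorem poissonKernel_nonneg_of_mem {w z : ℂ} (hw : w ∈ ball (0 : ℂ) 1)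
    (hz : z ∈ sphere (0 : ℂ) 1) : 0 ≤ poissonKernel 0 w z := by
  rw [mem_ball_zero_iff] at hw
  rw [mem_sphere_zero_iff_norm] at hz
  have h : ‖w‖ ^ 2 ≤ 1 := pow_le_one₀ (norm_nonneg w) hw.le
  rw [poissonKernel_def, sub_zero, sub_zero, hz]
  exact div_nonneg (by linarith) (by positivity)

theorem circleAverage_poissonKernel_smul_const {w : ℂ} (hw : w ∈ ball (0 : ℂ) 1) (C : ℂ) :
    circleAverage (poissonKernel 0 w • fun _ ↦ C) 0 1 = C :=
  (diffContOnCl_const (c := C)).circleAverage_poissonKernel_smul hw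

/-- The Poisson integral is a contraction for the supremum norm. -/
theorem norm_circleAverage_poissonKernel_smul_le {f : ℂ → ℂ} {C : ℝ}
    (hC : ∀ z ∈ sphere (0 : ℂ) 1, ‖f z‖ ≤ C) {w : ℂ} (hw : w ∈ ball (0 : ℂ) 1) :
    ‖circleAverage (poissonKernel 0 w • f) 0 1‖ ≤ C := by
  have hconst := circleIntegrable_poissonKernel_smul (f := fun _ ↦ (C : ℂ)) continuousOn_const hw
  have hconst' : IntervalIntegrable (fun θ ↦ poissonKernel 0 w (circleMap 0 1 θ) * C) volume
      0 (2 * π) := by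
    simpa [Complex.reCLM_apply] using
      (intervalIntegrable_iff.2 (Complex.reCLM.integrable_comp (intervalIntegrable_iff.1 hconst)) :)
  have havg : (2 * π)⁻¹ * ∫ θ in 0..2 * π, poissonKernel 0 w (circleMap 0 1 θ) * C = C := by
    have := circleAverage_poissonKernel_smul_const hw C
    simp only [circleAverage_def, Pi.smul_apply', real_smul] at this
    rw [← ofReal_inj, ofReal_mul, ← intervalIntegral.integral_ofReal]
    simpa only [ofReal_mul] using this
  rw [circleAverage_def, norm_smul, norm_of_nonneg (by positivity)]
  refine (mul_le_mul_of_nonneg_left ?_ (by positivity)).trans havg.le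
  refine intervalIntegral.norm_integral_le_of_norm_le (by positivity)
    (.of_forall fun θ _ ↦ ?_) hconst'
  have hθ : circleMap 0 1 θ ∈ sphere (0 : ℂ) 1 := circleMap_mem_sphere _ zero_le_one _
  have hk := poissonKernel_nonneg_of_mem hw hθ
  rw [Pi.smul_apply', norm_smul, norm_of_nonneg hk]
  exact mul_le_mul_of_nonneg_left (hC _ hθ) hk

theorem circleAverage_poissonKernel_smul_conj {f : ℂ → ℂ} {w : ℂ} :
    circleAverage (poissonKernel 0 w • fun z ↦ conj (f z)) 0 1 =
      conj (circleAverage (poissonKernel 0 w • f) 0 1) := by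
  simp only [circleAverage_def, Pi.smul_apply', real_smul, map_mul, conj_ofReal,
    intervalIntegral.integral_of_le two_pi_pos.le, ← integral_conj]

/-- Every trigonometric polynomial extends continuously to a function on the plane which is the
Poisson integral of its boundary values. -/
theorem exists_poisson_extension_of_mem_span_fourier {p : C(AddCircle (2 * π), ℂ)}
    (hp : p ∈ Submodule.span ℂ (Set.range (@fourier (2 * π)))) :
    ∃ h : ℂ → ℂ, Continuous h ∧
      (∀ w ∈ ball (0 : ℂ) 1, circleAverage (poissonKernel 0 w • h) 0 1 = h w) ∧
      ∀ x : AddCircle (2 * π), h x.toCircle = p x := by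
  induction hp using Submodule.span_induction with
  | mem p hp =>
    obtain ⟨n, rfl⟩ := hp
    have key (m : ℕ) (w : ℂ) (hw : w ∈ ball (0 : ℂ) 1) :
        circleAverage (poissonKernel 0 w • fun z ↦ z ^ m) 0 1 = w ^ m :=
      (Differentiable.diffContOnCl (by fun_prop)).circleAverage_poissonKernel_smul hw
    obtain ⟨m, rfl | rfl⟩ := n.eq_nat_or_neg
    · exact ⟨fun z ↦ z ^ m, by fun_prop, key m, fun x ↦ by simp [AddCircle.toCircle_nsmul]⟩
    · refine ⟨fun z ↦ conj (z ^ m), by fun_prop, fun w hw ↦ ?_, fun x ↦ ?_⟩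
      · rw [circleAverage_poissonKernel_smul_conj, key m w hw]
      · rw [fourier_neg]
        simp [AddCircle.toCircle_nsmul]
  | zero => exact ⟨0, continuous_const, fun w _ ↦ by simp [circleAverage_def], fun _ ↦ rfl⟩
  | add p q _ _ hp hq =>
    obtain ⟨g, hgc, hg, hgp⟩ := hp
    obtain ⟨h, hhc, hh, hhq⟩ := hq
    refine ⟨g + h, hgc.add hhc, fun w hw ↦ ?_, fun x ↦ by simp [hgp, hhq]⟩
    rw [smul_add, circleAverage_add (circleIntegrable_poissonKernel_smul hgc.continuousOn hw)
      (circleIntegrable_poissonKernel_smul hhc.continuousOn hw), hg w hw, hh w hw, Pi.add_apply]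
  | smul a p _ hp =>
    obtain ⟨g, hgc, hg, hgp⟩ := hp
    refine ⟨a • g, hgc.const_smul a, fun w hw ↦ ?_, fun x ↦ by simp [hgp]⟩
    rw [smul_comm, circleAverage_smul, hg w hw, Pi.smul_apply]

/-- The Poisson integral of a continuous function on the unit circle solves the Dirichlet problem:
it extends continuously to the closed disc by the given boundary values. -/
theorem continuousOn_poissonIntegral {f : ℂ → ℂ} (hf : ContinuousOn f (sphere 0 1)) :
    ContinuousOn (fun w ↦ if ‖w‖ < 1 then circleAverage (poissonKernel 0 w • f) 0 1 else f w)
      (closedBall 0 1) := by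
  have : Fact (0 < 2 * π) := ⟨two_pi_pos⟩
  refine continuousOn_of_uniform_approx_of_continuousOn fun u hu ↦ ?_
  obtain ⟨ε, hε, hεu⟩ := Metric.mem_uniformity_dist.1 hu
  let F : C(AddCircle (2 * π), ℂ) :=
    ⟨fun x ↦ f x.toCircle, hf.comp_continuous (by fun_prop) fun x ↦ by
      rw [mem_sphere_zero_iff_norm, Circle.norm_coe]⟩
  have hF : F ∈ (Submodule.span ℂ (Set.range (@fourier (2 * π)))).topologicalClosure := by
    simp [span_fourier_closure_eq_top]
  obtain ⟨p, hp, hFp⟩ := Metric.mem_closure_iff.1 hF (ε / 2) (by positivity)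
  obtain ⟨h, hhc, hh, hhp⟩ := exists_poisson_extension_of_mem_span_fourier hp
  have hfh (z : ℂ) (hz : z ∈ sphere (0 : ℂ) 1) : ‖(f - h) z‖ ≤ ε / 2 := by
    obtain ⟨x, hx⟩ := (AddCircle.homeomorphCircle two_pi_pos.ne').surjective
      ⟨z, by simpa [Submonoid.unitSphere] using hz⟩
    rw [AddCircle.homeomorphCircle_apply] at hx
    have hdist := (ContinuousMap.dist_apply_le_dist x).trans hFp.le
    rw [← hhp, dist_eq_norm] at hdist
    simpa [F, hx] using hdist
  refine ⟨h, hhc.continuousOn, fun w hw ↦ hεu (lt_of_le_of_lt ?_ (half_lt_self hε))⟩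
  rw [dist_eq_norm]
  split_ifs with hw1
  · have hwb : w ∈ ball (0 : ℂ) 1 := by simpa using hw1
    rw [← hh w hwb, ← circleAverage_sub (circleIntegrable_poissonKernel_smul hf hwb)
      (circleIntegrable_poissonKernel_smul hhc.continuousOn hwb), ← smul_sub]
    exact norm_circleAverage_poissonKernel_smul_le hfh hwb
  · exact hfh w (by simpa using le_antisymm (by simpa using hw) (not_lt.1 hw1))

/-- If the moments `∫ ζ ^ n f` vanish for all `n`, so does the integral of `f` against
the geometric series `(1 - a ζ)⁻¹`. -/
theorem circleAverage_inv_one_sub_mul_eq_zero {f : ℂ → ℂ} (hf : ContinuousOn f (sphere 0 1))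
    (hmom : ∀ n : ℕ, circleAverage (fun ζ ↦ ζ ^ n * f ζ) 0 1 = 0) {a : ℂ} (ha : ‖a‖ < 1) :
    circleAverage (fun ζ ↦ (1 - a * ζ)⁻¹ * f ζ) 0 1 = 0 := by
  have hfc : Continuous fun θ ↦ f (circleMap 0 1 θ) :=
    hf.comp_continuous (continuous_circleMap 0 1) fun θ ↦ circleMap_mem_sphere _ zero_le_one _
  have hgeom (θ : ℝ) : HasSum (fun n : ℕ ↦ (a * circleMap 0 1 θ) ^ n * f (circleMap 0 1 θ))
      ((1 - a * circleMap 0 1 θ)⁻¹ * f (circleMap 0 1 θ)) := by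
    have h : ‖a * circleMap 0 1 θ‖ < 1 := by simpa using ha
    exact (hasSum_geometric_of_norm_lt_one h).mul_right _
  have hsum := intervalIntegral.hasSum_integral_of_dominated_convergence (μ := volume)
    (a := 0) (b := 2 * π)
    (F := fun (n : ℕ) θ ↦ (a * circleMap 0 1 θ) ^ n * f (circleMap 0 1 θ))
    (f := fun θ ↦ (1 - a * circleMap 0 1 θ)⁻¹ * f (circleMap 0 1 θ))
    (fun n θ ↦ ‖a‖ ^ n * ‖f (circleMap 0 1 θ)‖)
    (fun n ↦ (((continuous_const.mul (continuous_circleMap 0 1)).pow n).mul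
      hfc).aestronglyMeasurable)
    (fun n ↦ .of_forall fun θ _ ↦ by simp)
    (.of_forall fun θ _ ↦ (summable_geometric_of_lt_one (norm_nonneg a) ha).mul_right _)
    (by
      simp only [tsum_mul_right]
      exact (continuous_const.mul hfc.norm).intervalIntegrable _ _)
    (.of_forall fun θ _ ↦ hgeom θ)
  have hzero (n : ℕ) :
      ∫ θ in 0..2 * π, (a * circleMap 0 1 θ) ^ n * f (circleMap 0 1 θ) = 0 := by
    have h := hmom n
    rw [circleAverage_def, smul_eq_zero] at h
    simp only [mul_pow, mul_assoc, intervalIntegral.integral_const_mul]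
    rw [h.resolve_left (by positivity), mul_zero]
  simp only [hzero] at hsum
  rw [circleAverage_def, hsum.unique hasSum_zero, smul_zero]

/-- If all moments `∫ ζ ^ n f` vanish, the Poisson integral of `f` is half of its
Herglotz–Riesz integral, hence holomorphic. -/
theorem circleAverage_poissonKernel_smul_eq_herglotzRieszKernel {f : ℂ → ℂ}
    (hf : ContinuousOn f (sphere 0 1))
    (hmom : ∀ n : ℕ, circleAverage (fun ζ ↦ ζ ^ n * f ζ) 0 1 = 0)
    {w : ℂ} (hw : w ∈ ball (0 : ℂ) 1) :
    circleAverage (poissonKernel 0 w • f) 0 1 =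
      2⁻¹ * circleAverage (fun ζ ↦ herglotzRieszKernel 0 w ζ • f ζ) 0 1 := by
  have hw' : ‖conj w‖ < 1 := by simpa using hw
  have hne (ζ : ℂ) (hζ : ζ ∈ sphere (0 : ℂ) 1) : 1 - conj w * ζ ≠ 0 := by
    intro h
    have h1 : ‖conj w * ζ‖ = 1 := by rw [← sub_eq_zero.1 h, norm_one]
    rw [norm_mul, mem_sphere_zero_iff_norm.1 hζ, mul_one] at h1
    exact hw'.ne h1
  have hH : ContinuousOn (herglotzRieszKernel 0 w) (sphere 0 1) := by
    simpa using continuousOn_herglotzRieszKernel_sphere (R := 1) hw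
  have hci₁ : CircleIntegrable (fun ζ ↦ (2⁻¹ : ℂ) • (herglotzRieszKernel 0 w ζ • f ζ)) 0 1 :=
    ContinuousOn.circleIntegrable zero_le_one (by fun_prop)
  have hci₂ : CircleIntegrable (fun ζ ↦ (1 - conj w * ζ)⁻¹ * f ζ) 0 1 :=
    ContinuousOn.circleIntegrable zero_le_one <|
      ContinuousOn.mul (ContinuousOn.inv₀ (by fun_prop) hne) hf
  have hci₃ : CircleIntegrable (fun ζ ↦ (2⁻¹ : ℂ) • f ζ) 0 1 :=
    ContinuousOn.circleIntegrable zero_le_one (by fun_prop)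
  have hsplit : Set.EqOn (poissonKernel 0 w • f)
      ((fun ζ ↦ (2⁻¹ : ℂ) • (herglotzRieszKernel 0 w ζ • f ζ))
        + (fun ζ ↦ (1 - conj w * ζ)⁻¹ * f ζ) - fun ζ ↦ (2⁻¹ : ℂ) • f ζ) (sphere 0 |1|) := by
    intro ζ hζ
    rw [abs_one] at hζ
    have h1 := hne ζ hζ
    have hζ0 : ζ * conj ζ = 1 := by
      rw [mul_conj, normSq_eq_norm_sq, mem_sphere_zero_iff_norm.1 hζ]; simp
    have hζw : ζ - w ≠ 0 := by
      rintro h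
      rw [sub_eq_zero.1 h] at hζ
      exact (mem_ball.1 hw).ne (mem_sphere.1 hζ)
    have hconj : conj ζ - conj w ≠ 0 := by rwa [← map_sub, Ne, map_eq_zero]
    have hre : ((poissonKernel 0 w ζ : ℝ) : ℂ) =
        (herglotzRieszKernel 0 w ζ + conj (herglotzRieszKernel 0 w ζ)) / 2 := by
      rw [poissonKernel_eq_re_herglotzRieszKernel, Function.comp_apply, re_eq_add_conj]
    have hH : conj (herglotzRieszKernel 0 w ζ) = 2 * (1 - conj w * ζ)⁻¹ - 1 := by
      rw [herglotzRieszKernel_def]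
      simp only [sub_zero, map_div₀, map_add, map_sub]
      field_simp
      linear_combination (-2 * conj w) * hζ0
    simp only [Pi.smul_apply', Pi.sub_apply, Pi.add_apply, real_smul, smul_eq_mul, hre, hH]
    ring
  have h0 : circleAverage f 0 1 = 0 := by simpa using hmom 0
  rw [circleAverage_congr_sphere hsplit, circleAverage_sub (hci₁.add hci₂) hci₃,
    circleAverage_add hci₁ hci₂, circleAverage_inv_one_sub_mul_eq_zero hf hmom hw',
    circleAverage_fun_smul, circleAverage_fun_smul, h0]
  simp

end PoissonIntegral

/-- The moment conditions: if all Fourier coefficients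
`∫_0^{2π} ψ(e^{iθ}) e^{inθ} dθ`, `n ≥ 0`, of a continuous function `ψ` on the unit circle
vanish, then `ψ` is the boundary value of a function continuous on the closed disc,
holomorphic on the open disc, and vanishing at the origin. -/
theorem stmt4 (ψ : ℂ → ℂ)
    (hc : ContinuousOn ψ (sphere (0 : ℂ) 1))
    (hmom : ∀ n : ℤ, 0 ≤ n →
      (∫ θ in (0 : ℝ)..(2 * Real.pi), ψ (exp (θ * I)) * exp ((n : ℂ) * θ * I)) = 0) :
    ∃ Ψ : ℂ → ℂ, ContinuousOn Ψ (closedBall 0 1) ∧ DifferentiableOn ℂ Ψ (ball 0 1) ∧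
      (∀ ζ : ℂ, ‖ζ‖ = 1 → Ψ ζ = ψ ζ) ∧ Ψ 0 = 0 := by
  have hmom' (n : ℕ) : Real.circleAverage (fun ζ ↦ ζ ^ n * ψ ζ) 0 1 = 0 := by
    have h := hmom n n.cast_nonneg
    rw [Real.circleAverage_def, smul_eq_zero]
    right
    refine Eq.trans (intervalIntegral.integral_congr fun θ _ ↦ ?_) h
    simp only [circleMap, zero_add, ofReal_one, one_mul, ← Complex.exp_nat_mul]
    rw [mul_comm, Int.cast_natCast, mul_assoc]
  refine ⟨_, continuousOn_poissonIntegral hc, ?_, fun ζ hζ ↦ by simp [hζ], ?_⟩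
  · refine ((differentiableOn_circleAverage_herglotzRieszKernel_smul
      (hc.circleIntegrable zero_le_one)).const_mul (2⁻¹ : ℂ)).congr fun w hw ↦ ?_
    rw [if_pos (mem_ball_zero_iff.1 hw),
      circleAverage_poissonKernel_smul_eq_herglotzRieszKernel hc hmom' hw]
  · rw [if_pos (by simp), circleAverage_poissonKernel_smul_eq_herglotzRieszKernel hc hmom'
      (mem_ball_self one_pos), mul_eq_zero]
    right
    refine Eq.trans (Real.circleAverage_congr_sphere fun ζ hζ ↦ ?_) (hmom' 0)
    have hζ0 : ζ ≠ 0 := by rintro rfl; simp at hζ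
    simp [herglotzRieszKernel_def, hζ0]
end
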